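/- There exists a universal constant c > 0 such that for any phase P of the algorithm TC (with α even), TC(P) ≤ c·h(T)·OPT(P) + c·h(T)·(k_P + k_ONL)·α, where TC(P) is the cost TC pays during P and OPT(P) is the minimum cost of serving the requests of P by an offline algorithm with cache size k_OPT that may start the phase with an arbitrary cache. -/

import Mathlib

open scoped Classical

/-!
Common setup for the online tree caching problem
(Bienkowski, Marcinkowski, Pacut, Schmid, Spyra, "Online Tree Caching").
-/

/-- A finite rooted tree on the vertex type `V`: every vertex has a parent,
the root is its own parent, and iterating `parent` from any vertex reaches the root. -/
structure RTree (V : Type) where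
  root : V
  parent : V → V
  parent_root : parent root = root
  reaches_root : ∀ v : V, ∃ n : ℕ, parent^[n] v = root

namespace RTree

variable {V : Type}

/-- The subtree `T(u)`: `u` together with all its descendants. -/
def subtree (T : RTree V) (u : V) : Set V :=
  {v | ∃ n : ℕ, T.parent^[n] v = u}

/-- `C` is a subforest of `T`: with every node it contains the whole subtree below it. -/
def Subforest (T : RTree V) (C : Set V) : Prop :=
  ∀ v ∈ C, T.subtree v ⊆ C

/-- `A` is a tree cap rooted at `v`: `A ⊆ T(v)`, `v ∈ A`, and `A` is closed under
taking the parent (towards `v`). -/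
def TreeCap (T : RTree V) (v : V) (A : Set V) : Prop :=
  A ⊆ T.subtree v ∧ v ∈ A ∧ ∀ u ∈ A, u ≠ v → T.parent u ∈ A

/-- `X` is a valid positive changeset for the cache `C`. -/
def ValidPos (T : RTree V) (C X : Set V) : Prop :=
  X.Nonempty ∧ X ∩ C = ∅ ∧ T.Subforest (C ∪ X)

/-- `X` is a valid negative changeset for the cache `C`. -/
def ValidNeg (T : RTree V) (C X : Set V) : Prop :=
  X.Nonempty ∧ X ⊆ C ∧ T.Subforest (C \ X)

/-- `X` is a valid changeset for the cache `C`. -/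
def Valid (T : RTree V) (C X : Set V) : Prop :=
  T.ValidPos C X ∨ T.ValidNeg C X

/-- `w` is the root of a tree (connected component) of the subforest `C`. -/
def IsCompRoot (T : RTree V) (C : Set V) (w : V) : Prop :=
  w ∈ C ∧ (w = T.root ∨ T.parent w ∉ C)

/-- The depth of a node: its distance to the root. -/
noncomputable def depth [DecidableEq V] (T : RTree V) (v : V) : ℕ :=
  Nat.find (T.reaches_root v)

/-- The height `h(T)` of the tree: its number of levels. -/
noncomputable def height [Fintype V] [DecidableEq V] (T : RTree V) : ℕ :=
  (Finset.univ.sup fun v => T.depth v) + 1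

end RTree

/-- A request: a node together with a sign (`true` = positive, `false` = negative). -/
abbrev Request (V : Type) := V × Bool

/-- The request `r` incurs cost `1` when the cache is `C`
(a positive request to a non-cached node, or a negative request to a cached node). -/
def Costly {V : Type} (r : Request V) (C : Set V) : Prop :=
  (r.2 = true ∧ r.1 ∉ C) ∨ (r.2 = false ∧ r.1 ∈ C)

/-- The sum of the counters `f` over the set of nodes `A`. -/
noncomputable def cntSum {V : Type} [Fintype V] (f : V → ℕ) (A : Set V) : ℕ :=
  ∑ v : V, A.indicator f v

/-- The number of nodes of a changeset (`0` for no changeset). -/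
noncomputable def chgSize {V : Type} : Option (Set V) → ℕ
  | none => 0
  | some X => X.ncard

/-- One phase of the algorithm `TC` on the request sequence `req` (the request of
round `t ≥ 1` is `req t`), starting at time `0` with an empty cache.
`cache t` is the cache contents during round `t`; `cnt t` are the counter values just
after serving the request of round `t` (used for the decision at time `t`);
`chg t` is the changeset applied at time `t` (right after round `t`), if any. -/
structure TCPhase {V : Type} [Fintype V] [DecidableEq V]
    (T : RTree V) (α : ℕ) (req : ℕ → Request V) where
  cache : ℕ → Set V
  cnt : ℕ → V → ℕ
  chg : ℕ → Option (Set V)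
  cache_subforest : ∀ t, T.Subforest (cache t)
  cache_zero : cache 0 = ∅
  cnt_zero : ∀ v, cnt 0 v = 0
  cnt_rec : ∀ t v, cnt (t + 1) v =
    (if ∃ X, chg t = some X ∧ v ∈ X then 0 else cnt t v)
    + (if (req (t + 1)).1 = v ∧ Costly (req (t + 1)) (cache (t + 1)) then 1 else 0)
  step_some : ∀ t X, chg t = some X →
    T.Valid (cache t) X ∧
    X.ncard * α ≤ cntSum (cnt t) X ∧
    (∀ Y, T.Valid (cache t) Y → X ⊂ Y → cntSum (cnt t) Y < Y.ncard * α) ∧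
    cache (t + 1) = if T.ValidPos (cache t) X then cache t ∪ X else cache t \ X
  step_none : ∀ t, chg t = none →
    cache (t + 1) = cache t ∧
    ∀ X, T.Valid (cache t) X → cntSum (cnt t) X < X.ncard * α

namespace TCPhase

variable {V : Type} [Fintype V] [DecidableEq V]
  {T : RTree V} {α : ℕ} {req : ℕ → Request V}

/-- The counter values at time `t`, right after the cache change at time `t`
(counters of fetched/evicted nodes are reset to `0`). -/
noncomputable def cntPost (E : TCPhase T α req) (t : ℕ) (v : V) : ℕ :=
  if ∃ X, E.chg t = some X ∧ v ∈ X then 0 else E.cnt t v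

/-- `last_v(t)`: the last time strictly before `t` at which `v` changed its
cached/non-cached state (`0`, the beginning of the phase, if there is none). -/
noncomputable def lastChg (E : TCPhase T α req) (v : V) (t : ℕ) : ℕ :=
  ((Finset.range t).filter fun s => ¬ ((v ∈ E.cache s) ↔ v ∈ E.cache (s + 1))).sup id

/-- The slot `(v, r)` belongs to the field `F^t`. -/
def inField (E : TCPhase T α req) (t : ℕ) (v : V) (r : ℕ) : Prop :=
  ∃ X, E.chg t = some X ∧ v ∈ X ∧ E.lastChg v t < r ∧ r ≤ t

/-- The number of requests of the sequence `ρ` lying in slots of `F^t_{≤ τ} ∩ D`. -/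
noncomputable def fieldReqIn (E : TCPhase T α req) (ρ : ℕ → Request V)
    (t : ℕ) (D : Set V) (τ : ℕ) : ℕ :=
  ((Finset.Icc 1 t).filter fun r => r ≤ τ ∧ (ρ r).1 ∈ D ∧ E.inField t (ρ r).1 r).card

/-- `req(F^t)`: the number of requests of `ρ` in slots of the field `F^t`. -/
noncomputable def fieldReq (E : TCPhase T α req) (ρ : ℕ → Request V) (t : ℕ) : ℕ :=
  E.fieldReqIn ρ t Set.univ t

/-- `size(F^t_{≤ τ} ∩ D)`: the number of distinct nodes having a slot in `F^t_{≤ τ} ∩ D`. -/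
noncomputable def fieldSizeIn (E : TCPhase T α req) (t : ℕ) (D : Set V) (τ : ℕ) : ℕ :=
  (Finset.univ.filter fun v : V => v ∈ D ∧ ∃ r, r ≤ τ ∧ E.inField t v r).card

/-- The standing assumption: no positive requests are given to cached nodes and no
negative requests to non-cached ones (so every request incurs cost `1` for `TC`). -/
def GoodReq (E : TCPhase T α req) : Prop :=
  ∀ t, 1 ≤ t →
    ((req t).2 = true → (req t).1 ∉ E.cache t) ∧
    ((req t).2 = false → (req t).1 ∈ E.cache t)

/-- The phase consists of rounds `1, …, tEnd`: no cache of `TC` before time `tEnd`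
exceeds the capacity `kONL` (at time `tEnd` the triggered fetch, if any, is performed
even if it exceeds the capacity, and is followed by the final eviction). -/
def PhaseEnd (E : TCPhase T α req) (kONL tEnd : ℕ) : Prop :=
  ∀ t, t < tEnd → (E.cache (t + 1)).ncard ≤ kONL

/-- `k_P`: the number of nodes in `TC`'s cache at the end of the phase
(after the fetch at time `tEnd`, before the final eviction). -/
noncomputable def kP (E : TCPhase T α req) (tEnd : ℕ) : ℕ :=
  (E.cache (tEnd + 1)).ncard

/-- The phase ending at `tEnd` is finished: the fetch at time `tEnd` exceeded the
capacity `kONL`. -/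
def FinishedAt (E : TCPhase T α req) (kONL tEnd : ℕ) : Prop :=
  E.PhaseEnd kONL tEnd ∧ kONL < E.kP tEnd

/-- `size(𝓕)`: the total size of all fields of the phase. -/
noncomputable def sizeFields (E : TCPhase T α req) (tEnd : ℕ) : ℕ :=
  ∑ t ∈ Finset.Icc 1 tEnd, chgSize (E.chg t)

/-- `req(F^∞)`: the number of requests of the phase lying in slots of the open field
(slots covered by no field of the phase). -/
noncomputable def openReq (E : TCPhase T α req) (tEnd : ℕ) : ℕ :=
  ((Finset.Icc 1 tEnd).filter fun r => ∀ t, t ≤ tEnd → ¬ E.inField t (req r).1 r).card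

/-- `TC(P)`: the total cost paid by `TC` during the phase: serving the requests,
fetching/evicting the applied changesets (`α` per node), and the final eviction
(`α · k_P`) if the phase is finished. -/
noncomputable def tcCost (E : TCPhase T α req) (kONL tEnd : ℕ) : ℕ :=
  ((Finset.Icc 1 tEnd).filter fun r => Costly (req r) (E.cache r)).card
  + α * E.sizeFields tEnd
  + (if kONL < E.kP tEnd then α * E.kP tEnd else 0)

/-- The tree cap `Y` (rooted at `u`, inside the negative field `F^t`) is proper for
the request sequence `ρ`: it holds `req(F^t ∩ Y) = |Y| · α`, and `F^t_{≤ τ} ∩ D` is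
not over-requested for every tree cap `D ⊆ Y` rooted at `u` and every time `τ ≤ t`. -/
def Proper (E : TCPhase T α req) (ρ : ℕ → Request V) (t : ℕ) (u : V) (Y : Set V) : Prop :=
  E.fieldReqIn ρ t Y t = Y.ncard * α ∧
  ∀ (D : Set V) (τ : ℕ), T.TreeCap u D → D ⊆ Y → τ ≤ t →
    E.fieldReqIn ρ t D τ ≤ E.fieldSizeIn t D τ * α

end TCPhase

/-- `D` is a feasible cache schedule for an (offline) algorithm with cache size `k`:
at every time the cache is a subforest of `T` of at most `k` nodes. -/
def IsSchedule {V : Type} (T : RTree V) (k : ℕ) (D : ℕ → Set V) : Prop :=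
  ∀ t, T.Subforest (D t) ∧ (D t).ncard ≤ k

/-- The cost of serving the requests of rounds `a, …, b` of `ρ` when the cache during
round `r` is `D r`. -/
noncomputable def serveCost {V : Type} (ρ : ℕ → Request V) (D : ℕ → Set V) (a b : ℕ) : ℕ :=
  ((Finset.Icc a b).filter fun r => Costly (ρ r) (D r)).card

/-- The reorganization cost of the schedule `D` (`α` per fetched or evicted node) over
the times `a, …, b - 1` (the change at time `t` leads from `D t` to `D (t+1)`). -/
noncomputable def moveCost {V : Type} (α : ℕ) (D : ℕ → Set V) (a b : ℕ) : ℕ :=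
  α * ∑ t ∈ Finset.Ico a b, ((D (t + 1) \ D t).ncard + (D t \ D (t + 1)).ncard)

/-- `OPT`: the minimum cost of serving rounds `a, …, b` of `ρ` by an offline algorithm
with cache size `k` that may start with an arbitrary cache. -/
noncomputable def optCostFrom {V : Type} (T : RTree V) (α k : ℕ)
    (ρ : ℕ → Request V) (a b : ℕ) : ℕ :=
  sInf {n | ∃ D : ℕ → Set V, IsSchedule T k D ∧
    n = serveCost ρ D a b + moveCost α D a b}

/-- `OPT`: the minimum cost of serving rounds `1, …, b` of `ρ` by an offline algorithm
with cache size `k` that starts with the empty cache. -/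
noncomputable def optCostEmpty {V : Type} (T : RTree V) (α k : ℕ)
    (ρ : ℕ → Request V) (b : ℕ) : ℕ :=
  sInf {n | ∃ D : ℕ → Set V, IsSchedule T k D ∧ D 0 = ∅ ∧
    n = serveCost ρ D 1 b + moveCost α D 0 b}

/-- `ρ'` is obtained from `ρ` by legally shifting requests: signs are preserved, every
positive request is moved to a descendant of its node (or kept), and every negative
request is moved to an ancestor of its node (or kept). -/
def LegalShift {V : Type} (T : RTree V) (ρ ρ' : ℕ → Request V) : Prop :=
  ∀ t, (ρ' t).2 = (ρ t).2 ∧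
    ((ρ t).2 = true → (ρ' t).1 ∈ T.subtree (ρ t).1) ∧
    ((ρ t).2 = false → (ρ t).1 ∈ T.subtree (ρ' t).1)

/-- A full run of the algorithm `TC` with cache capacity `kONL` on the request
sequence `req`, including phase restarts: whenever the fetch of a saturated changeset
would exceed the capacity, `TC` instead evicts its whole cache and a new phase starts
(`newPhase t` holds, and all counters are reset). -/
structure TCRun {V : Type} [Fintype V] [DecidableEq V]
    (T : RTree V) (α kONL : ℕ) (req : ℕ → Request V) where
  cache : ℕ → Set V
  cnt : ℕ → V → ℕ
  chg : ℕ → Option (Set V)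
  newPhase : ℕ → Prop
  cache_subforest : ∀ t, T.Subforest (cache t)
  cache_zero : cache 0 = ∅
  cnt_zero : ∀ v, cnt 0 v = 0
  capacity : ∀ t, (cache t).ncard ≤ kONL
  cnt_rec : ∀ t v, cnt (t + 1) v =
    (if newPhase t ∨ ∃ X, chg t = some X ∧ v ∈ X then 0 else cnt t v)
    + (if (req (t + 1)).1 = v ∧ Costly (req (t + 1)) (cache (t + 1)) then 1 else 0)
  step_some : ∀ t X, chg t = some X →
    T.Valid (cache t) X ∧
    X.ncard * α ≤ cntSum (cnt t) X ∧
    (∀ Y, T.Valid (cache t) Y → X ⊂ Y → cntSum (cnt t) Y < Y.ncard * α) ∧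
    ((T.ValidPos (cache t) X ∧ (cache t ∪ X).ncard ≤ kONL ∧
        cache (t + 1) = cache t ∪ X ∧ ¬ newPhase t) ∨
     (T.ValidPos (cache t) X ∧ kONL < (cache t ∪ X).ncard ∧
        cache (t + 1) = ∅ ∧ newPhase t) ∨
     (T.ValidNeg (cache t) X ∧ cache (t + 1) = cache t \ X ∧ ¬ newPhase t))
  step_none : ∀ t, chg t = none →
    cache (t + 1) = cache t ∧ ¬ newPhase t ∧
    ∀ X, T.Valid (cache t) X → cntSum (cnt t) X < X.ncard * α

/-- `TC(I)`: the total cost paid by the run `E` of `TC` on the rounds `1, …, N`: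
serving the requests, plus `α` per fetched/evicted node (on a phase restart the whole
cache is evicted). -/
noncomputable def TCRun.cost {V : Type} [Fintype V] [DecidableEq V]
    {T : RTree V} {α kONL : ℕ} {req : ℕ → Request V}
    (E : TCRun T α kONL req) (N : ℕ) : ℕ :=
  ((Finset.Icc 1 N).filter fun r => Costly (req r) (E.cache r)).card
  + α * ∑ t ∈ Finset.Icc 1 N,
      (if E.newPhase t then (E.cache t).ncard else chgSize (E.chg t))

namespace RTree

variable {V : Type} {T : RTree V}

theorem self_mem_subtree (v : V) : v ∈ T.subtree v := ⟨0, rfl⟩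

theorem subtree_trans {a b w : V} (hw : w ∈ T.subtree b) (hb : b ∈ T.subtree a) :
    w ∈ T.subtree a := by
  obtain ⟨n, rfl⟩ := hw
  obtain ⟨m, rfl⟩ := hb
  exact ⟨m + n, Function.iterate_add_apply _ _ _ _⟩

theorem subtree_total {a b w : V} (ha : w ∈ T.subtree a) (hb : w ∈ T.subtree b) :
    a ∈ T.subtree b ∨ b ∈ T.subtree a := by
  obtain ⟨n, rfl⟩ := ha
  obtain ⟨m, rfl⟩ := hb
  rcases le_total n m with h | h
  · obtain ⟨k, rfl⟩ := Nat.exists_eq_add_of_le h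
    exact Or.inl ⟨k, by rw [← Function.iterate_add_apply, Nat.add_comm]⟩
  · obtain ⟨k, rfl⟩ := Nat.exists_eq_add_of_le h
    exact Or.inr ⟨k, by rw [← Function.iterate_add_apply, Nat.add_comm]⟩

theorem iterate_parent_root (T : RTree V) (n : ℕ) : T.parent^[n] T.root = T.root :=
  Function.iterate_fixed T.parent_root n

theorem card_ancestors_le_height [Fintype V] [DecidableEq V] (w : V) :
    (Finset.univ.filter fun v => w ∈ T.subtree v).card ≤ T.height := by
  have hsub : (Finset.univ.filter fun v => w ∈ T.subtree v) ⊆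
      (Finset.range (T.depth w + 1)).image fun n => T.parent^[n] w := by
    intro v hv
    obtain ⟨n, rfl⟩ := (Finset.mem_filter.1 hv).2
    rw [Finset.mem_image]
    have hd : T.parent^[T.depth w] w = T.root := Nat.find_spec (T.reaches_root w)
    by_cases h : n ≤ T.depth w
    · exact ⟨n, by simpa [Nat.lt_succ_iff] using h, rfl⟩
    · obtain ⟨k, rfl⟩ := Nat.exists_eq_add_of_le (not_le.1 h).le
      refine ⟨T.depth w, by simp, ?_⟩
      rw [Nat.add_comm, Function.iterate_add_apply, hd, iterate_parent_root]
  refine (Finset.card_le_card hsub).trans (Finset.card_image_le.trans ?_)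
  rw [Finset.card_range, height]
  exact Nat.succ_le_succ (Finset.le_sup (f := fun v => T.depth v) (Finset.mem_univ w))

theorem ValidNeg.mem_of_descendant {C X : Set V} (h : T.ValidNeg C X) {w b : V} (hw : w ∈ X)
    (hb : b ∈ C) (hwb : w ∈ T.subtree b) : b ∈ X := by
  by_contra hX
  exact (h.2.2 b ⟨hb, hX⟩ hwb).2 hw

theorem ValidPos.not_validNeg {C X : Set V} (h : T.ValidPos C X) : ¬ T.ValidNeg C X := by
  intro h'
  obtain ⟨x, hx⟩ := h.1
  have : x ∈ X ∩ C := ⟨hx, h'.2.1 hx⟩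
  rw [h.2.1] at this
  exact this

theorem validNeg_of_upward_closed {C X : Set V} (hC : T.Subforest C) (hne : X.Nonempty)
    (hX : X ⊆ C) (hup : ∀ w ∈ X, ∀ b ∈ C, w ∈ T.subtree b → b ∈ X) : T.ValidNeg C X :=
  ⟨hne, hX, fun b hb w hw => ⟨hC b hb.1 hw, fun hwX => hb.2 (hup w hwX b hb.1 hw)⟩⟩

theorem Subforest.validPos_subtree_diff {C : Set V} (hC : T.Subforest C) {v : V} (hv : v ∉ C) :
    T.ValidPos C (T.subtree v \ C) := by
  refine ⟨⟨v, self_mem_subtree v, hv⟩, by simp, fun b hb w hw => ?_⟩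
  by_cases hwC : w ∈ C
  · exact Or.inl hwC
  · rcases hb with hb | hb
    · exact Or.inl (hC b hb hw)
    · exact Or.inr ⟨subtree_trans hw hb.1, hwC⟩

end RTree

section CounterSums

variable {V : Type} [Fintype V]

theorem cntSum_eq_sum_filter (f : V → ℕ) (A : Set V) :
    cntSum f A = ∑ v ∈ Finset.univ.filter (· ∈ A), f v := by
  simp [cntSum, Set.indicator_apply, Finset.sum_filter]

theorem ncard_eq_card_filter (A : Set V) :
    A.ncard = (Finset.univ.filter (· ∈ A)).card := by
  rw [← Set.ncard_coe_finset]; simp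

theorem cntSum_empty (f : V → ℕ) : cntSum f ∅ = 0 := by simp [cntSum]

theorem cntSum_mono (f : V → ℕ) {A B : Set V} (h : A ⊆ B) : cntSum f A ≤ cntSum f B := by
  rw [cntSum_eq_sum_filter, cntSum_eq_sum_filter]
  exact Finset.sum_le_sum_of_subset (Finset.monotone_filter_right _ fun v _ hv => h hv)

theorem cntSum_union (f : V → ℕ) {A B : Set V} (h : Disjoint A B) :
    cntSum f (A ∪ B) = cntSum f A + cntSum f B := by
  simp [cntSum, Set.indicator_union_of_disjoint h, Finset.sum_add_distrib]

end CounterSums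

namespace TCPhase

variable {V : Type} [Fintype V] [DecidableEq V]
  {T : RTree V} {α : ℕ} {req : ℕ → Request V} (E : TCPhase T α req)

theorem cntPost_of_none {t : ℕ} (h : E.chg t = none) : E.cntPost t = E.cnt t := by
  funext v; simp [cntPost, h]

theorem cntSum_cntPost_of_some {t : ℕ} {X : Set V} (h : E.chg t = some X) (Y : Set V) :
    cntSum (E.cntPost t) Y = cntSum (E.cnt t) (Y \ X) := by
  unfold cntSum
  refine Finset.sum_congr rfl fun v _ => ?_
  by_cases hY : v ∈ Y <;> by_cases hX : v ∈ X <;> simp [cntPost, h, hX, hY]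

theorem cntSum_succ (t : ℕ) (A : Set V) :
    cntSum (E.cnt (t + 1)) A = cntSum (E.cntPost t) A +
      if (req (t + 1)).1 ∈ A ∧ Costly (req (t + 1)) (E.cache (t + 1)) then 1 else 0 := by
  rw [cntSum_eq_sum_filter, cntSum_eq_sum_filter]
  have h : ∀ v, E.cnt (t + 1) v = E.cntPost t v +
      if (req (t + 1)).1 = v ∧ Costly (req (t + 1)) (E.cache (t + 1)) then 1 else 0 :=
    E.cnt_rec t
  simp only [h, Finset.sum_add_distrib, ite_and, Finset.sum_ite_eq]
  simp

theorem cntSum_zero (A : Set V) : cntSum (E.cnt 0) A = 0 := by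
  rw [cntSum_eq_sum_filter]; simp [E.cnt_zero]

theorem step_cases (t : ℕ) :
    (E.cache (t + 1) = E.cache t ∧ E.chg t = none) ∨
    (∃ X, E.chg t = some X ∧ T.ValidPos (E.cache t) X ∧ E.cache (t + 1) = E.cache t ∪ X) ∨
    (∃ X, E.chg t = some X ∧ T.ValidNeg (E.cache t) X ∧ E.cache (t + 1) = E.cache t \ X) := by
  rcases h : E.chg t with _ | X
  · exact Or.inl ⟨(E.step_none t h).1, rfl⟩
  · obtain ⟨hv, -, -, hc⟩ := E.step_some t X h
    rcases hv with hv | hv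
    · exact Or.inr (Or.inl ⟨X, rfl, hv, by rw [hc, if_pos hv]⟩)
    · exact Or.inr (Or.inr ⟨X, rfl, hv, by rw [hc, if_neg fun h' => h'.not_validNeg hv]⟩)

/-- Two disjoint valid changesets cannot be saturated simultaneously if before the
request neither was. -/
theorem not_saturated_disjoint {t : ℕ}
    (ih : ∀ Y, T.Valid (E.cache (t + 1)) Y → cntSum (E.cntPost t) Y < Y.ncard * α)
    {X Z : Set V} (hX : T.Valid (E.cache (t + 1)) X) (hZ : T.Valid (E.cache (t + 1)) Z)
    (hd : Disjoint X Z) (hsX : X.ncard * α ≤ cntSum (E.cnt (t + 1)) X) :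
    cntSum (E.cnt (t + 1)) Z < Z.ncard * α := by
  have h1 := ih X hX
  have h2 := ih Z hZ
  rw [cntSum_succ] at hsX ⊢
  by_cases hr : (req (t + 1)).1 ∈ X
  · have : (req (t + 1)).1 ∉ Z := fun h => Set.disjoint_left.1 hd hr h
    simpa [this] using h2
  · simp only [hr, false_and, if_false] at hsX
    omega

/-- After a cache change no valid changeset is saturated. -/
theorem cntSum_cntPost_lt (hα : 1 ≤ α) (t : ℕ) :
    ∀ Y, T.Valid (E.cache (t + 1)) Y → cntSum (E.cntPost t) Y < Y.ncard * α := by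
  induction t with
  | zero =>
    intro Y hY
    have hpos : ∀ X, T.Valid (E.cache 0) X → 0 < X.ncard * α := by
      intro X hX
      have : X.Nonempty := hX.elim (·.1) (·.1)
      exact Nat.mul_pos ((Set.ncard_pos).2 this) hα
    rcases h : E.chg 0 with _ | X
    · rw [E.cntPost_of_none h]
      rw [(E.step_none 0 h).1] at hY
      exact (E.step_none 0 h).2 Y hY
    · obtain ⟨hv, hs, -⟩ := E.step_some 0 X h
      rw [cntSum_zero] at hs
      exact absurd (hpos X hv) (by omega)
  | succ t ih =>
    intro Y hY
    rcases E.step_cases (t + 1) with ⟨hc, hn⟩ | ⟨X, hX, hv, hc⟩ | ⟨X, hX, hv, hc⟩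
    · rw [E.cntPost_of_none hn]
      rw [hc] at hY
      exact (E.step_none _ hn).2 Y hY
    · obtain ⟨-, hs, hmax, -⟩ := E.step_some _ X hX
      rw [E.cntSum_cntPost_of_some hX]
      rw [hc] at hY
      rcases hY with hY | hY
      · have hYC : Y ∩ E.cache (t + 1) = ∅ := by
          have := hY.2.1
          rw [Set.inter_union_distrib_left, Set.union_empty_iff] at this
          exact this.1
        have hYX : Disjoint X Y := by
          have := hY.2.1
          rw [Set.inter_union_distrib_left, Set.union_empty_iff] at this
          exact (Set.disjoint_iff_inter_eq_empty.2 this.2).symm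
        have := hmax (X ∪ Y) (Or.inl ⟨hv.1.inl, by
          rw [Set.union_inter_distrib_right, hv.2.1, hYC, Set.union_empty], by
          rw [← Set.union_assoc]; exact hY.2.2⟩) (by
          refine ⟨Set.subset_union_left, fun h => ?_⟩
          obtain ⟨y, hy⟩ := hY.1
          exact Set.disjoint_left.1 hYX (h (Or.inr hy)) hy)
        rw [cntSum_union _ hYX, Set.ncard_union_eq hYX] at this
        rw [hYX.symm.sdiff_eq_left]
        nlinarith
      · rcases (Y \ X).eq_empty_or_nonempty with he | hne
        · rw [he, cntSum_empty]
          exact Nat.mul_pos ((Set.ncard_pos).2 hY.1) hα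
        · have hZ : T.ValidNeg (E.cache (t + 1)) (Y \ X) := by
            refine RTree.validNeg_of_upward_closed (E.cache_subforest _) hne ?_ ?_
            · rintro y ⟨hy, hyX⟩
              exact (hY.2.1 hy).resolve_right hyX
            · rintro w ⟨hw, hwX⟩ b hb hwb
              refine ⟨hY.mem_of_descendant hw (Or.inl hb) hwb, fun hbX => ?_⟩
              have : b ∈ X ∩ E.cache (t + 1) := ⟨hbX, hb⟩
              rw [hv.2.1] at this
              exact this
          have := E.not_saturated_disjoint ih (Or.inl hv) (Or.inr hZ)
            Set.disjoint_sdiff_right hs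
          exact this.trans_le (Nat.mul_le_mul_right _ (Set.ncard_le_ncard Set.sdiff_subset))
    · obtain ⟨-, hs, hmax, -⟩ := E.step_some _ X hX
      rw [E.cntSum_cntPost_of_some hX]
      rw [hc] at hY
      rcases hY with hY | hY
      · rcases (Y \ X).eq_empty_or_nonempty with he | hne
        · rw [he, cntSum_empty]
          exact Nat.mul_pos ((Set.ncard_pos).2 hY.1) hα
        · have hZ : T.ValidPos (E.cache (t + 1)) (Y \ X) := by
            refine ⟨hne, ?_, ?_⟩
            · ext y
              simp only [Set.mem_inter_iff, Set.mem_sdiff, Set.mem_empty_iff_false, iff_false]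
              rintro ⟨⟨hy, hyX⟩, hyC⟩
              have : y ∈ Y ∩ (E.cache (t + 1) \ X) := ⟨hy, hyC, hyX⟩
              rw [hY.2.1] at this
              exact this
            · intro b hb w hw
              rcases hb with hb | ⟨hb, -⟩
              · exact Or.inl (E.cache_subforest _ b hb hw)
              · rcases hY.2.2 b (Or.inr hb) hw with h | h
                · exact Or.inl h.1
                · by_cases hwX : w ∈ X
                  · exact Or.inl (hv.2.1 hwX)
                  · exact Or.inr ⟨h, hwX⟩
          have := E.not_saturated_disjoint ih (Or.inr hv) (Or.inl hZ)
            Set.disjoint_sdiff_right hs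
          exact this.trans_le (Nat.mul_le_mul_right _ (Set.ncard_le_ncard Set.sdiff_subset))
      · have hYX : Disjoint X Y := Set.disjoint_left.2 fun x hx hxY => (hY.2.1 hxY).2 hx
        have := hmax (X ∪ Y) (Or.inr ⟨hv.1.inl,
          Set.union_subset hv.2.1 (hY.2.1.trans Set.sdiff_subset), by
          rw [← Set.sdiff_sdiff]; exact hY.2.2⟩) (by
          refine ⟨Set.subset_union_left, fun h => ?_⟩
          obtain ⟨y, hy⟩ := hY.1
          exact Set.disjoint_left.1 hYX (h (Or.inr hy)) hy)
        rw [cntSum_union _ hYX, Set.ncard_union_eq hYX] at this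
        rw [hYX.symm.sdiff_eq_left]
        nlinarith

theorem cntSum_le (hα : 1 ≤ α) {t : ℕ} {Y : Set V} (hY : T.Valid (E.cache t) Y) :
    cntSum (E.cnt t) Y ≤ Y.ncard * α := by
  cases t with
  | zero => rw [cntSum_zero]; exact Nat.zero_le _
  | succ t =>
    rw [cntSum_succ]
    have := E.cntSum_cntPost_lt hα t Y hY
    split_ifs <;> omega

theorem not_mem_cache_iff_iff (t : ℕ) (v : V) :
    (¬ (v ∈ E.cache t ↔ v ∈ E.cache (t + 1))) ↔ ∃ X, E.chg t = some X ∧ v ∈ X := by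
  rcases E.step_cases t with ⟨hc, hn⟩ | ⟨X, hX, hv, hc⟩ | ⟨X, hX, hv, hc⟩
  · simp [hc, hn]
  · have : v ∈ X → v ∉ E.cache t := fun h h' => by
      have h2 : v ∈ X ∩ E.cache t := ⟨h, h'⟩
      rw [hv.2.1] at h2
      exact h2
    simp only [hc, hX, Set.mem_union, Option.some.injEq, exists_eq_left']
    tauto
  · have := @hv.2.1 v
    simp only [hc, hX, Set.mem_sdiff, Option.some.injEq, exists_eq_left']
    tauto

end TCPhase

section SignCount

variable {V : Type}

/-- The number of requests of sign `b` in the first `t` rounds. -/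
noncomputable def signCount (req : ℕ → Request V) (b : Bool) (t : ℕ) : ℕ :=
  ((Finset.Icc 1 t).filter fun r => (req r).2 = b).card

theorem signCount_succ (req : ℕ → Request V) (b : Bool) (t : ℕ) :
    signCount req b (t + 1) = signCount req b t + if (req (t + 1)).2 = b then 1 else 0 := by
  unfold signCount
  rw [← Finset.insert_Icc_right_eq_Icc_add_one (by omega), Finset.filter_insert]
  split_ifs
  · rw [Finset.card_insert_of_notMem (by simp)]
  · rfl

end SignCount

namespace TCPhase

variable {V : Type} [Fintype V] [DecidableEq V]
  {T : RTree V} {α : ℕ} {req : ℕ → Request V} (E : TCPhase T α req)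

theorem lastChg_succ (v : V) (t : ℕ) :
    E.lastChg v (t + 1) =
      if v ∈ E.cache t ↔ v ∈ E.cache (t + 1) then E.lastChg v t else t := by
  have hle : E.lastChg v t ≤ t := Finset.sup_le fun s hs => by
    simpa using (Finset.mem_range.1 (Finset.mem_filter.1 hs).1).le
  unfold lastChg at hle ⊢
  rw [Finset.range_add_one, Finset.filter_insert]
  by_cases h : v ∈ E.cache t ↔ v ∈ E.cache (t + 1)
  · rw [if_neg (not_not.2 h), if_pos h]
  · rw [if_pos h, if_neg h, Finset.sup_insert]
    simpa using hle

theorem lastChg_zero (v : V) : E.lastChg v 0 = 0 := by simp [lastChg]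

theorem lastChg_lt {v : V} {t : ℕ} (ht : 0 < t) : E.lastChg v t < t :=
  (Finset.sup_lt_iff ht).2 fun _ hs => Finset.mem_range.1 (Finset.mem_filter.1 hs).1

theorem le_lastChg {v : V} {s t : ℕ} (hst : s < t)
    (h : ¬ (v ∈ E.cache s ↔ v ∈ E.cache (s + 1))) : s ≤ E.lastChg v t :=
  Finset.le_sup (f := id) (Finset.mem_filter.2 ⟨Finset.mem_range.2 hst, h⟩)

theorem mem_cache_iff_of_lastChg_lt {v : V} {r t : ℕ} (hr : E.lastChg v t < r) (hrt : r ≤ t) :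
    v ∈ E.cache r ↔ v ∈ E.cache t := by
  have : ∀ s, r ≤ s → s ≤ t → (v ∈ E.cache r ↔ v ∈ E.cache s) := by
    intro s hs
    induction s, hs using Nat.le_induction with
    | base => exact fun _ => Iff.rfl
    | succ s hs ih =>
      intro hst
      refine (ih (by omega)).trans ?_
      by_contra h
      have := E.le_lastChg (t := t) (by omega) h
      omega
  exact this t hrt le_rfl

theorem lastChg_lt_of_const {v : V} {r t : ℕ} (hr : 0 < r)
    (h : ∀ s, r ≤ s → s < t → (v ∈ E.cache s ↔ v ∈ E.cache (s + 1))) : E.lastChg v t < r := by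
  refine (Finset.sup_lt_iff hr).2 fun s hs => ?_
  obtain ⟨h1, h2⟩ := Finset.mem_filter.1 hs
  by_contra h3
  exact h2 (h s (not_lt.1 h3) (Finset.mem_range.1 h1))

theorem not_mem_cache_lastChg {v : V} {t : ℕ} (h : v ∈ E.cache t) :
    v ∉ E.cache (E.lastChg v t) := by
  induction t with
  | zero => simp [E.cache_zero] at h
  | succ t ih =>
    rw [lastChg_succ]
    split_ifs with h'
    · exact ih (h'.2 h)
    · tauto

theorem lastChg_le_of_forall_mem {v : V} {s t : ℕ}
    (h : ∀ r, s < r → r ≤ t → v ∈ E.cache r) : E.lastChg v t ≤ s := by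
  have := E.lastChg_lt_of_const (v := v) (t := t) (Nat.succ_pos s) fun r hr hrt =>
    iff_of_true (h r hr hrt.le) (h (r + 1) (by omega) hrt)
  omega

/-- In a phase with good requests, the counter of `v` is the number of requests at `v` since
its last state change. -/
theorem cnt_eq_card (hG : E.GoodReq) (v : V) (t : ℕ) :
    E.cnt t v = ((Finset.Ioc (E.lastChg v t) t).filter fun r => (req r).1 = v).card := by
  induction t with
  | zero => simp [E.cnt_zero]
  | succ t ih =>
    have hcost : Costly (req (t + 1)) (E.cache (t + 1)) := by
      obtain ⟨h1, h2⟩ := hG (t + 1) (by omega)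
      cases hs : (req (t + 1)).2
      · exact Or.inr ⟨hs, h2 hs⟩
      · exact Or.inl ⟨hs, h1 hs⟩
    have hrec := E.cnt_rec t v
    rw [lastChg_succ]
    simp only [← E.not_mem_cache_iff_iff] at hrec
    by_cases h : v ∈ E.cache t ↔ v ∈ E.cache (t + 1)
    · have hle : E.lastChg v t ≤ t := by
        rcases t.eq_zero_or_pos with rfl | ht
        · rw [lastChg_zero]
        · exact (E.lastChg_lt ht).le
      rw [if_pos h, ← Finset.insert_Ioc_right_eq_Ioc_add_one hle, Finset.filter_insert]
      rw [if_neg (not_not.2 h), ih] at hrec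
      rw [hrec]
      by_cases hv : (req (t + 1)).1 = v
      · rw [if_pos ⟨hv, hcost⟩, if_pos hv, Finset.card_insert_of_notMem (by simp)]
      · rw [if_neg (fun h => hv h.1), if_neg hv, Nat.add_zero]
    · rw [if_pos h] at hrec
      rw [hrec, if_neg h]
      by_cases hv : (req (t + 1)).1 = v
      · simp [hv, hcost, Finset.filter_singleton]
      · simp [hv, Finset.filter_singleton]

/-- The last time strictly before `t` at which `v` was evicted (`0` if there is none). -/
noncomputable def lastEv (v : V) (t : ℕ) : ℕ :=
  ((Finset.range t).filter fun s => v ∈ E.cache s ∧ v ∉ E.cache (s + 1)).sup id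

theorem lastEv_succ (v : V) (t : ℕ) :
    E.lastEv v (t + 1) =
      if v ∈ E.cache t ∧ v ∉ E.cache (t + 1) then t else E.lastEv v t := by
  have hle : E.lastEv v t ≤ t := Finset.sup_le fun s hs => by
    simpa using (Finset.mem_range.1 (Finset.mem_filter.1 hs).1).le
  unfold lastEv at hle ⊢
  rw [Finset.range_add_one, Finset.filter_insert]
  split_ifs
  · rw [Finset.sup_insert]
    simpa using hle
  · rfl

theorem lastEv_zero (v : V) : E.lastEv v 0 = 0 := by simp [lastEv]

theorem lastEv_lt {v : V} {t : ℕ} (ht : 0 < t) : E.lastEv v t < t :=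
  (Finset.sup_lt_iff ht).2 fun _ hs => Finset.mem_range.1 (Finset.mem_filter.1 hs).1

theorem lastEv_eq_lastChg {v : V} {t : ℕ} (h : v ∉ E.cache t) :
    E.lastEv v t = E.lastChg v t := by
  induction t with
  | zero => rw [lastEv_zero, lastChg_zero]
  | succ t ih =>
    rw [lastEv_succ, lastChg_succ]
    by_cases h' : v ∈ E.cache t
    · simp [h, h']
    · simp [h, h', ih h']

theorem lastEv_eq_of_forall {v : V} {r q : ℕ} (hrq : r ≤ q)
    (h : ∀ s, r ≤ s → s < q → v ∈ E.cache s → v ∈ E.cache (s + 1)) :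
    E.lastEv v q = E.lastEv v r := by
  induction q, hrq using Nat.le_induction with
  | base => rfl
  | succ q hq ih =>
    rw [lastEv_succ, if_neg fun h' => h'.2 (h q hq (by omega) h'.1)]
    exact ih fun s h1 h2 => h s h1 (by omega)

theorem le_lastEv {v : V} {s t : ℕ} (hst : s < t)
    (h : v ∈ E.cache s ∧ v ∉ E.cache (s + 1)) : s ≤ E.lastEv v t :=
  Finset.le_sup (f := id) (Finset.mem_filter.2 ⟨Finset.mem_range.2 hst, h⟩)

theorem costly_of_goodReq (hG : E.GoodReq) {r : ℕ} (hr : 1 ≤ r) :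
    Costly (req r) (E.cache r) := by
  obtain ⟨h1, h2⟩ := hG r hr
  cases hs : (req r).2
  · exact Or.inr ⟨hs, h2 hs⟩
  · exact Or.inl ⟨hs, h1 hs⟩

theorem fetched_step (t : ℕ) :
    α * (E.cache (t + 1) \ E.cache t).ncard + cntSum (E.cntPost t) (E.cache (t + 1))ᶜ
      ≤ cntSum (E.cnt t) (E.cache t)ᶜ := by
  rcases E.step_cases t with ⟨hc, hn⟩ | ⟨X, hX, hv, hc⟩ | ⟨X, hX, hv, hc⟩
  · simp [hc, E.cntPost_of_none hn]
  · have hs := (E.step_some t X hX).2.1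
    have hd : Disjoint X (E.cache t) := Set.disjoint_iff_inter_eq_empty.2 hv.2.1
    rw [hc, E.cntSum_cntPost_of_some hX, Set.union_sdiff_left, hd.sdiff_eq_left, mul_comm]
    refine (Nat.add_le_add_right hs _).trans ?_
    rw [← cntSum_union _ (Set.disjoint_left.2 fun x hx hx' => hx'.2 hx)]
    refine cntSum_mono _ (Set.union_subset (fun x hx => Set.disjoint_left.1 hd hx) ?_)
    exact fun x hx h => hx.1 (Or.inl h)
  · rw [E.cntSum_cntPost_of_some hX, hc, Set.sdiff_eq_empty.2 Set.sdiff_subset, Set.ncard_empty,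
      mul_zero, zero_add]
    exact cntSum_mono _ fun x hx h => hx.1 ⟨h, hx.2⟩

theorem evicted_step (hα : 1 ≤ α) (t : ℕ) :
    cntSum (E.cnt t) (E.cache t)
      ≤ α * (E.cache t \ E.cache (t + 1)).ncard + cntSum (E.cntPost t) (E.cache (t + 1)) := by
  rcases E.step_cases t with ⟨hc, hn⟩ | ⟨X, hX, hv, hc⟩ | ⟨X, hX, hv, hc⟩
  · simp [hc, E.cntPost_of_none hn]
  · have hd : Disjoint X (E.cache t) := Set.disjoint_iff_inter_eq_empty.2 hv.2.1
    rw [E.cntSum_cntPost_of_some hX, hc]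
    refine le_add_left (cntSum_mono _ fun x hx => ⟨Or.inl hx, fun h => ?_⟩)
    exact Set.disjoint_left.1 hd h hx
  · have hs := E.cntSum_le hα (Or.inr hv)
    rw [E.cntSum_cntPost_of_some hX, hc, Set.sdiff_sdiff_cancel_left hv.2.1, mul_comm]
    refine le_trans ?_ (Nat.add_le_add_right hs _)
    rw [← cntSum_union _ (Set.disjoint_left.2 fun x hx hx' => hx'.2 hx)]
    exact cntSum_mono _ fun x hx => by by_cases h : x ∈ X <;> simp [h, hx]

theorem fetched_le (hG : E.GoodReq) (t : ℕ) :
    α * ∑ s ∈ Finset.range (t + 1), (E.cache (s + 1) \ E.cache s).ncard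
      ≤ signCount req true t := by
  have key : ∀ t, α * ∑ s ∈ Finset.range t, (E.cache (s + 1) \ E.cache s).ncard +
      cntSum (E.cnt t) (E.cache t)ᶜ ≤ signCount req true t := by
    intro t
    induction t with
    | zero => simp [cntSum_zero]
    | succ t ih =>
      have h1 := E.fetched_step t
      rw [Finset.sum_range_succ, mul_add, cntSum_succ, signCount_succ]
      have h2 : (req (t + 1)).1 ∈ (E.cache (t + 1))ᶜ ∧ Costly (req (t + 1)) (E.cache (t + 1)) →
          (req (t + 1)).2 = true := fun h => by
        by_contra h'
        exact h.1 ((hG (t + 1) (by omega)).2 (by simpa using h'))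
      by_cases h : (req (t + 1)).1 ∈ (E.cache (t + 1))ᶜ ∧
          Costly (req (t + 1)) (E.cache (t + 1))
      · rw [if_pos h, if_pos (h2 h)]
        omega
      · rw [if_neg h]
        omega
  have h1 := E.fetched_step t
  have h2 := key t
  rw [Finset.sum_range_succ, mul_add]
  omega

theorem signCount_false_le (hα : 1 ≤ α) (hG : E.GoodReq) (t : ℕ) :
    signCount req false t
      ≤ α * ∑ s ∈ Finset.range t, (E.cache s \ E.cache (s + 1)).ncard
        + α * (E.cache t).ncard := by
  have key : signCount req false t
      ≤ α * ∑ s ∈ Finset.range t, (E.cache s \ E.cache (s + 1)).ncard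
        + cntSum (E.cnt t) (E.cache t) := by
    induction t with
    | zero => simp [signCount]
    | succ t ih =>
      have h1 := E.evicted_step hα t
      rw [Finset.sum_range_succ, mul_add, cntSum_succ, signCount_succ]
      have h2 : (if (req (t + 1)).2 = false then 1 else 0) ≤
          if (req (t + 1)).1 ∈ E.cache (t + 1) ∧
            Costly (req (t + 1)) (E.cache (t + 1)) then 1 else 0 := by
        split_ifs with h h' <;> try omega
        exact absurd ⟨(hG (t + 1) (by omega)).2 h, E.costly_of_goodReq hG (by omega)⟩ h'
      omega
  refine key.trans (Nat.add_le_add_left ?_ _)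
  rcases (E.cache t).eq_empty_or_nonempty with h | h
  · rw [h, cntSum_empty]; exact Nat.zero_le _
  · rw [mul_comm]
    exact E.cntSum_le hα (Or.inr (RTree.validNeg_of_upward_closed (E.cache_subforest t) h
      subset_rfl fun _ _ b hb _ => hb))

theorem evicted_le_fetched (t : ℕ) :
    ∑ s ∈ Finset.range t, (E.cache s \ E.cache (s + 1)).ncard
      ≤ ∑ s ∈ Finset.range t, (E.cache (s + 1) \ E.cache s).ncard := by
  have key : ∑ s ∈ Finset.range t, (E.cache s \ E.cache (s + 1)).ncard + (E.cache t).ncard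
      = ∑ s ∈ Finset.range t, (E.cache (s + 1) \ E.cache s).ncard := by
    induction t with
    | zero => simp [E.cache_zero]
    | succ t ih =>
      have h1 := Set.ncard_sdiff_add_ncard (E.cache t) (E.cache (t + 1))
      have h2 := Set.ncard_sdiff_add_ncard (E.cache (t + 1)) (E.cache t)
      rw [Set.union_comm] at h2
      rw [Finset.sum_range_succ, Finset.sum_range_succ]
      omega
  omega

theorem chgSize_chg (t : ℕ) :
    chgSize (E.chg t)
      = (E.cache (t + 1) \ E.cache t).ncard + (E.cache t \ E.cache (t + 1)).ncard := by
  rcases E.step_cases t with ⟨hc, hn⟩ | ⟨X, hX, hv, hc⟩ | ⟨X, hX, hv, hc⟩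
  · simp [hc, hn, chgSize]
  · have hd : Disjoint X (E.cache t) := Set.disjoint_iff_inter_eq_empty.2 hv.2.1
    rw [hX, hc, Set.union_sdiff_left, hd.sdiff_eq_left,
      Set.sdiff_eq_empty.2 Set.subset_union_left, Set.ncard_empty]
    rfl
  · rw [hX, hc, Set.sdiff_sdiff_cancel_left hv.2.1, Set.sdiff_eq_empty.2 Set.sdiff_subset,
      Set.ncard_empty, zero_add]
    rfl

theorem sizeFields_le (t : ℕ) :
    E.sizeFields t ≤ 2 * ∑ s ∈ Finset.range (t + 1), (E.cache (s + 1) \ E.cache s).ncard := by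
  have h : E.sizeFields t ≤ ∑ s ∈ Finset.range (t + 1), chgSize (E.chg s) := by
    refine Finset.sum_le_sum_of_subset fun s hs => ?_
    simp only [Finset.mem_Icc, Finset.mem_range] at hs ⊢
    omega
  simp only [chgSize_chg, Finset.sum_add_distrib] at h
  have := E.evicted_le_fetched (t + 1)
  omega

/-- The cost of a phase in terms of the number of positive requests. -/
theorem tcCost_le (hα : 1 ≤ α) (hG : E.GoodReq) {kONL t : ℕ} (hP : E.PhaseEnd kONL t) :
    E.tcCost kONL t ≤ 4 * signCount req true t + α * kONL + α * E.kP t := by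
  have h1 := E.fetched_le hG t
  have h2 := E.signCount_false_le hα hG t
  have h3 := Nat.mul_le_mul_left α (E.evicted_le_fetched t)
  have h4 := Nat.mul_le_mul_left α (E.sizeFields_le t)
  have h5 : (E.cache t).ncard ≤ kONL := by
    cases t with
    | zero => simp [E.cache_zero]
    | succ t => exact hP t (by omega)
  have h5 := Nat.mul_le_mul_left α h5
  have h6 : ((Finset.Icc 1 t).filter fun r => Costly (req r) (E.cache r)).card
      ≤ signCount req true t + signCount req false t := by
    unfold signCount
    refine (Finset.card_le_card fun r hr => ?_).trans (Finset.card_union_le _ _)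
    simp only [Finset.mem_filter, Finset.mem_union] at hr ⊢
    cases hs : (req r).2 <;> simp [hr.1]
  have h7 : (if kONL < E.kP t then α * E.kP t else 0) ≤ α * E.kP t := by split_ifs <;> simp
  have h8 : α * ∑ s ∈ Finset.range t, (E.cache (s + 1) \ E.cache s).ncard ≤
      α * ∑ s ∈ Finset.range (t + 1), (E.cache (s + 1) \ E.cache s).ncard := by
    rw [Finset.sum_range_succ, mul_add]; exact Nat.le_add_right _ _
  unfold tcCost
  rw [Nat.mul_left_comm] at h4
  omega

end TCPhase

namespace TCPhase

variable {V : Type} [Fintype V] [DecidableEq V]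
  {T : RTree V} {α : ℕ} {req : ℕ → Request V} (E : TCPhase T α req)

/-- The schedule `D` holds `v` since the last state change of `v` before `t`. -/
def Held (D : ℕ → Set V) (t : ℕ) (v : V) : Prop :=
  ∀ r, E.lastChg v t < r → r ≤ t → v ∈ D r

/-- The earliest time at which an ancestor of `w` in `X` held by `D` was fetched (`t` if there
is no such ancestor). -/
noncomputable def barrier (D : ℕ → Set V) (t : ℕ) (X : Set V) (w : V) : ℕ :=
  (insert t ((Finset.univ.filter fun a => a ∈ X ∧ E.Held D t a ∧ w ∈ T.subtree a).image
    fun a => E.lastChg a t)).min' (Finset.insert_nonempty _ _)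

theorem barrier_le (D : ℕ → Set V) (t : ℕ) (X : Set V) (w : V) : E.barrier D t X w ≤ t :=
  Finset.min'_le _ _ (Finset.mem_insert_self _ _)

theorem barrier_le_lastChg {D : ℕ → Set V} {t : ℕ} {X : Set V} {w a : V} (ha : a ∈ X)
    (hh : E.Held D t a) (hw : w ∈ T.subtree a) : E.barrier D t X w ≤ E.lastChg a t :=
  Finset.min'_le _ _ (Finset.mem_insert_of_mem (Finset.mem_image.2 ⟨a, by simp [ha, hh, hw], rfl⟩))

theorem le_barrier {D : ℕ → Set V} {t : ℕ} {X : Set V} {w : V} {m : ℕ} (hm : m ≤ t)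
    (h : ∀ a ∈ X, E.Held D t a → w ∈ T.subtree a → m ≤ E.lastChg a t) :
    m ≤ E.barrier D t X w := by
  refine Finset.le_min' _ _ _ fun y hy => ?_
  rcases Finset.mem_insert.1 hy with rfl | hy
  · exact hm
  · obtain ⟨a, ha, rfl⟩ := Finset.mem_image.1 hy
    obtain ⟨-, h1, h2, h3⟩ := Finset.mem_filter.1 ha
    exact h a h1 h2 h3

theorem barrier_eq_or (D : ℕ → Set V) (t : ℕ) (X : Set V) (w : V) :
    E.barrier D t X w = t ∨
      ∃ a ∈ X, E.Held D t a ∧ w ∈ T.subtree a ∧ E.lastChg a t = E.barrier D t X w := by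
  have := Finset.min'_mem _ (Finset.insert_nonempty t
    ((Finset.univ.filter fun a => a ∈ X ∧ E.Held D t a ∧ w ∈ T.subtree a).image
      fun a => E.lastChg a t))
  rcases Finset.mem_insert.1 this with h | h
  · exact Or.inl h
  · obtain ⟨a, ha, h⟩ := Finset.mem_image.1 h
    obtain ⟨-, h1, h2, h3⟩ := Finset.mem_filter.1 ha
    exact Or.inr ⟨a, h1, h2, h3, h⟩

theorem barrier_mono {D : ℕ → Set V} {t : ℕ} {X : Set V} {w b : V} (h : w ∈ T.subtree b) :
    E.barrier D t X w ≤ E.barrier D t X b :=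
  E.le_barrier (E.barrier_le _ _ _ _) fun _ ha hh hb =>
    E.barrier_le_lastChg ha hh (RTree.subtree_trans h hb)

/-- The nodes of a negative changeset not held by `D` whose barrier is `τ`, and which are cached
in round `τ`, form a valid negative changeset for the cache of round `τ`. -/
theorem validNeg_barrier_eq {t : ℕ} (ht : 0 < t) {X : Set V}
    (hX : T.ValidNeg (E.cache t) X) (D : ℕ → Set V) {τ : ℕ}
    (hne : {w | w ∈ X ∧ ¬ E.Held D t w ∧ E.barrier D t X w = τ ∧ w ∈ E.cache τ}.Nonempty) :
    T.ValidNeg (E.cache τ)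
      {w | w ∈ X ∧ ¬ E.Held D t w ∧ E.barrier D t X w = τ ∧ w ∈ E.cache τ} := by
  refine RTree.validNeg_of_upward_closed (E.cache_subforest τ) hne (fun w hw => hw.2.2.2) ?_
  rintro w ⟨hwX, hwH, hτ, hwC⟩ b hbC hwb
  have hsub := E.cache_subforest
  have hle : E.barrier D t X w ≤ E.barrier D t X b := E.barrier_mono hwb
  rcases E.barrier_eq_or D t X w with h | ⟨a, haX, haH, hwa, h⟩
  · have hτt : τ = t := by omega
    subst hτt
    have hbX : b ∈ X := hX.mem_of_descendant hwX hbC hwb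
    refine ⟨hbX, fun hH => ?_, ?_, hbC⟩
    · have h1 := E.barrier_le_lastChg hbX hH hwb
      have h2 := E.lastChg_lt (v := b) ht
      omega
    · have := E.barrier_le D τ X b
      omega
  · have haC : a ∈ E.cache t := hX.2.1 haX
    have haτ : a ∉ E.cache τ := by
      rw [← hτ, ← h]
      exact E.not_mem_cache_lastChg haC
    have hba : b ∈ T.subtree a := by
      rcases RTree.subtree_total hwb hwa with h' | h'
      · exact h'
      · exact absurd (hsub τ b hbC h') haτ
    have hbX : b ∈ X := hX.mem_of_descendant hwX (hsub t a haC hba) hwb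
    refine ⟨hbX, fun hH => ?_, ?_, hbC⟩
    · have h1 := E.barrier_le_lastChg hbX hH hwb
      have h2 : E.lastChg b t ≤ E.lastChg a t := E.lastChg_le_of_forall_mem fun r hr hrt =>
        hsub r a ((E.mem_cache_iff_of_lastChg_lt hr hrt).2 haC) hba
      have h3 : E.lastChg b t = τ := by omega
      exact E.not_mem_cache_lastChg (hsub t a haC hba) (by rw [h3]; exact hbC)
    · have := E.barrier_le_lastChg haX haH hba
      omega

theorem card_le_cntSum (hG : E.GoodReq) {t : ℕ} {A : Set V} {S : Finset ℕ}
    (hS : ∀ r ∈ S, (req r).1 ∈ A ∧ r ∈ Finset.Ioc (E.lastChg (req r).1 t) t) :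
    S.card ≤ cntSum (E.cnt t) A := by
  rw [cntSum_eq_sum_filter, Finset.card_eq_sum_card_fiberwise (f := fun r => (req r).1)
    (t := Finset.univ.filter (· ∈ A)) (fun r hr => by simpa using (hS r hr).1)]
  refine Finset.sum_le_sum fun v _ => ?_
  rw [E.cnt_eq_card hG]
  refine Finset.card_le_card fun r hr => ?_
  obtain ⟨hr, hv⟩ := Finset.mem_filter.1 hr
  have := (hS r hr).2
  rw [hv] at this
  exact Finset.mem_filter.2 ⟨this, hv⟩

/-- The requests in a negative field that are free for `D`. -/
theorem card_free_field_le (hα : 1 ≤ α) (hG : E.GoodReq) {t : ℕ} (ht : 0 < t) {X : Set V}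
    (hX : T.ValidNeg (E.cache t) X) {D : ℕ → Set V} (hD : ∀ r, T.Subforest (D r)) :
    ((Finset.Icc 1 t).filter fun r =>
        (req r).1 ∈ X ∧ E.lastChg (req r).1 t < r ∧ (req r).1 ∉ D r).card
      ≤ (Finset.univ.filter fun v => v ∈ X ∧ ¬ E.Held D t v).card * α := by
  set R := (Finset.Icc 1 t).filter fun r =>
        (req r).1 ∈ X ∧ E.lastChg (req r).1 t < r ∧ (req r).1 ∉ D r with hR
  set U := Finset.univ.filter fun v => v ∈ X ∧ ¬ E.Held D t v with hU
  have hmR : ∀ r ∈ R, r ∈ Finset.Icc 1 t ∧ (req r).1 ∈ X ∧ E.lastChg (req r).1 t < r ∧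
      (req r).1 ∉ D r := fun r hr => by simpa [hR] using hr
  rw [Finset.card_eq_sum_card_fiberwise (s := R) (t := Finset.range (t + 1))
      (f := fun r => E.barrier D t X (req r).1)
      (fun r _ => by simpa [Nat.lt_succ_iff] using E.barrier_le D t X _),
    Finset.card_eq_sum_card_fiberwise (s := U) (t := Finset.range (t + 1))
      (f := fun v => E.barrier D t X v)
      (fun v _ => by simpa [Nat.lt_succ_iff] using E.barrier_le D t X v), Finset.sum_mul]
  refine Finset.sum_le_sum fun τ hτ => ?_
  have hτt : τ ≤ t := Nat.lt_succ_iff.1 (Finset.mem_range.1 hτ)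
  set Y : Set V := {w | w ∈ X ∧ ¬ E.Held D t w ∧ E.barrier D t X w = τ ∧ w ∈ E.cache τ} with hY
  have hYU : Y.ncard ≤ (U.filter fun v => E.barrier D t X v = τ).card := by
    rw [ncard_eq_card_filter]
    refine Finset.card_le_card fun v hv => ?_
    simp only [Finset.mem_filter, Finset.mem_univ, true_and, hY, Set.mem_ofPred_eq, hU] at hv ⊢
    tauto
  have hYc : cntSum (E.cnt τ) Y ≤ Y.ncard * α := by
    rcases Y.eq_empty_or_nonempty with h | h
    · rw [h, cntSum_empty]; exact Nat.zero_le _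
    · exact E.cntSum_le hα (Or.inr (E.validNeg_barrier_eq ht hX D h))
  refine le_trans ?_ (hYc.trans (Nat.mul_le_mul_right α hYU))
  have hfib : ∀ r ∈ R.filter (fun r => E.barrier D t X (req r).1 = τ),
      (req r).1 ∈ Y ∧ r ∈ Finset.Ioc (E.lastChg (req r).1 τ) τ := by
    intro r hr
    obtain ⟨hrR, hrτ⟩ := Finset.mem_filter.1 hr
    obtain ⟨hI, hrX, hl, hrD⟩ := hmR r hrR
    rw [Finset.mem_Icc] at hI
    have hle : r ≤ τ := by
      rw [← hrτ]
      refine E.le_barrier hI.2 fun a ha hH hw => ?_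
      by_contra hlt
      exact hrD (hD r a (hH r (by omega) hI.2) hw)
    have hC : ∀ s, r ≤ s → s ≤ t → (req r).1 ∈ E.cache s := fun s h1 h2 =>
      (E.mem_cache_iff_of_lastChg_lt (by omega) h2).2 (hX.2.1 hrX)
    refine ⟨⟨hrX, fun hH => hrD (hH r hl hI.2), hrτ, hC τ hle hτt⟩, ?_⟩
    rw [Finset.mem_Ioc]
    exact ⟨E.lastChg_lt_of_const hI.1 fun s h1 h2 =>
      iff_of_true (hC s h1 (by omega)) (hC (s + 1) (by omega) (by omega)), hle⟩
  exact E.card_le_cntSum hG hfib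

/-- `D` pays at least `α` in a negative field for every node it holds throughout the field. -/
theorem card_held_mul_le (hα : 1 ≤ α) (hG : E.GoodReq) {t : ℕ} (ht : 0 < t) {X : Set V}
    (hchg : E.chg t = some X) (hX : T.ValidNeg (E.cache t) X) {D : ℕ → Set V}
    (hD : ∀ r, T.Subforest (D r)) :
    (Finset.univ.filter fun v => v ∈ X ∧ E.Held D t v).card * α
      ≤ ((Finset.Icc 1 t).filter fun r =>
        (req r).1 ∈ X ∧ E.lastChg (req r).1 t < r ∧ (req r).1 ∈ D r).card := by
  have h1 := E.card_free_field_le hα hG ht hX hD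
  have h2 : X.ncard * α ≤ ((Finset.Icc 1 t).filter fun r =>
      (req r).1 ∈ X ∧ E.lastChg (req r).1 t < r).card := by
    refine (E.step_some t X hchg).2.1.trans ?_
    rw [cntSum_eq_sum_filter, Finset.card_eq_sum_card_fiberwise (f := fun r => (req r).1)
      (t := Finset.univ.filter (· ∈ X)) (fun r hr => by simp at hr ⊢; tauto)]
    refine Finset.sum_le_sum fun v hv => ?_
    rw [E.cnt_eq_card hG]
    refine Finset.card_le_card fun r hr => ?_
    simp only [Finset.mem_filter, Finset.mem_Ioc, Finset.mem_Icc, Finset.mem_univ,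
      true_and] at hr hv ⊢
    obtain ⟨⟨h3, h4⟩, rfl⟩ := hr
    exact ⟨⟨⟨by omega, h4⟩, hv, h3⟩, rfl⟩
  have h3 : X.ncard = (Finset.univ.filter fun v => v ∈ X ∧ E.Held D t v).card +
      (Finset.univ.filter fun v => v ∈ X ∧ ¬ E.Held D t v).card := by
    rw [ncard_eq_card_filter, ← Finset.card_filter_add_card_filter_not (E.Held D t),
      Finset.filter_filter, Finset.filter_filter]
  have h4 : ((Finset.Icc 1 t).filter fun r =>
      (req r).1 ∈ X ∧ E.lastChg (req r).1 t < r).card =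
      ((Finset.Icc 1 t).filter fun r =>
        (req r).1 ∈ X ∧ E.lastChg (req r).1 t < r ∧ (req r).1 ∈ D r).card +
      ((Finset.Icc 1 t).filter fun r =>
        (req r).1 ∈ X ∧ E.lastChg (req r).1 t < r ∧ (req r).1 ∉ D r).card := by
    rw [← Finset.card_filter_add_card_filter_not (fun r => (req r).1 ∈ D r),
      Finset.filter_filter, Finset.filter_filter]
    simp only [and_assoc]
  rw [h3, add_mul] at h2
  omega

/-- The pairs `(v, t)` such that `v` is evicted at time `t ≤ n` and `D` holds `v` throughout the
preceding in period. -/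
noncomputable def heldPairs (D : ℕ → Set V) (n : ℕ) : Finset (V × ℕ) :=
  (Finset.univ ×ˢ Finset.Icc 1 n).filter fun p =>
    (p.1 ∈ E.cache p.2 ∧ p.1 ∉ E.cache (p.2 + 1)) ∧ E.Held D p.2 p.1

theorem card_heldPairs_mul_le (hα : 1 ≤ α) (hG : E.GoodReq) {D : ℕ → Set V}
    (hD : ∀ r, T.Subforest (D r)) (n : ℕ) :
    (E.heldPairs D n).card * α ≤
      ((Finset.Icc 1 n).filter fun r => (req r).2 = false ∧ (req r).1 ∈ D r).card := by
  rw [Finset.card_eq_sum_card_fiberwise (f := Prod.snd) (t := Finset.Icc 1 n)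
    (fun p hp => by simp [heldPairs] at hp ⊢; tauto), Finset.sum_mul]
  set P : ℕ → Finset ℕ := fun t => (Finset.Icc 1 t).filter fun r =>
    ((req r).1 ∈ E.cache t ∧ (req r).1 ∉ E.cache (t + 1)) ∧
      E.lastChg (req r).1 t < r ∧ (req r).1 ∈ D r with hP
  have hmP : ∀ t r, r ∈ P t → (1 ≤ r ∧ r ≤ t) ∧
    ((req r).1 ∈ E.cache t ∧ (req r).1 ∉ E.cache (t + 1)) ∧
      E.lastChg (req r).1 t < r ∧ (req r).1 ∈ D r := fun t r hr => by simpa [hP] using hr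
  have hdisj : ∀ t t' r, r ∈ P t → r ∈ P t' → t' ≤ t := by
    intro t t' r hr hr'
    have h1 := hmP t r hr
    have h2 := hmP t' r hr'
    by_contra hlt
    have := E.le_lastChg (v := (req r).1) (s := t) (t := t') (by omega) (by tauto)
    omega
  calc
    _ ≤ ∑ t ∈ Finset.Icc 1 n, (P t).card := by
      refine Finset.sum_le_sum fun t ht => ?_
      have ht0 : 0 < t := (Finset.mem_Icc.1 ht).1
      have hfib : ((E.heldPairs D n).filter fun p => p.2 = t).card ≤
          (Finset.univ.filter fun v =>
            (v ∈ E.cache t ∧ v ∉ E.cache (t + 1)) ∧ E.Held D t v).card := by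
        refine Finset.card_le_card_of_injOn Prod.fst ?_ ?_
        · intro p hp
          simp only [heldPairs, Finset.coe_filter, Finset.mem_filter, Set.mem_ofPred_eq] at hp
          obtain ⟨⟨-, h⟩, rfl⟩ := hp
          simpa using h
        · intro p hp q hq hpq
          simp only [Finset.coe_filter, Set.mem_ofPred_eq] at hp hq
          exact Prod.ext hpq (hp.2.trans hq.2.symm)
      refine (Nat.mul_le_mul_right α hfib).trans ?_
      rcases E.step_cases t with ⟨hc, hn⟩ | ⟨X, hX, hv, hc⟩ | ⟨X, hX, hv, hc⟩
      · simp [hc]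
      · have : ∀ v, ¬ (v ∈ E.cache t ∧ v ∉ E.cache (t + 1)) := fun v h =>
          h.2 (by rw [hc]; exact Or.inl h.1)
        simp [this]
      · have : ∀ v, (v ∈ E.cache t ∧ v ∉ E.cache (t + 1)) ↔ v ∈ X := fun v => by
          rw [hc, Set.mem_sdiff]
          have := @hv.2.1 v
          tauto
        simp only [hP, this]
        exact E.card_held_mul_le hα hG ht0 hX hv hD
    _ = ((Finset.Icc 1 n).biUnion P).card := by
      rw [Finset.card_biUnion]
      intro t _ t' _ hne
      refine Finset.disjoint_left.2 fun r hr hr' => hne ?_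
      exact le_antisymm (hdisj _ _ r hr' hr) (hdisj _ _ r hr hr')
    _ ≤ _ := by
      refine Finset.card_le_card fun r hr => ?_
      obtain ⟨t, ht, hr⟩ := Finset.mem_biUnion.1 hr
      obtain ⟨h1, h2, h3, h4⟩ := hmP t r hr
      rw [Finset.mem_Icc] at ht
      refine Finset.mem_filter.2 ⟨Finset.mem_Icc.2 ⟨h1.1, by omega⟩, ?_, h4⟩
      by_contra hs
      exact (hG r h1.1).1 (by simpa using hs)
        ((E.mem_cache_iff_of_lastChg_lt h3 h1.2).2 h2.1)

end TCPhase

section Evictions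

variable {V : Type} [Fintype V]

/-- The pairs `(v, t)` with `1 ≤ t < n` such that `D` evicts `v` at time `t`. -/
noncomputable def evictions (D : ℕ → Set V) (n : ℕ) : Finset (V × ℕ) :=
  (Finset.univ ×ˢ Finset.Ico 1 n).filter fun p => p.1 ∈ D p.2 ∧ p.1 ∉ D (p.2 + 1)

theorem mul_card_evictions_le (a : ℕ) (D : ℕ → Set V) (n : ℕ) :
    a * (evictions D n).card ≤ moveCost a D 1 n := by
  refine Nat.mul_le_mul_left a ?_
  rw [Finset.card_eq_sum_card_fiberwise (f := Prod.snd) (t := Finset.Ico 1 n)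
    (fun p hp => by simp [evictions] at hp ⊢; tauto)]
  refine Finset.sum_le_sum fun t _ => le_add_left ?_
  rw [ncard_eq_card_filter]
  refine Finset.card_le_card_of_injOn Prod.fst ?_ ?_
  · intro p hp
    simp only [evictions, Finset.coe_filter, Finset.mem_filter, Set.mem_ofPred_eq] at hp
    obtain ⟨⟨-, h⟩, rfl⟩ := hp
    simpa using h
  · intro p hp q hq hpq
    simp only [Finset.coe_filter, Set.mem_ofPred_eq] at hp hq
    exact Prod.ext hpq (hp.2.trans hq.2.symm)

end Evictions

namespace TCPhase

variable {V : Type} [Fintype V] [DecidableEq V]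
  {T : RTree V} {α : ℕ} {req : ℕ → Request V} (E : TCPhase T α req)

/-- The out periods in which `D` caches the node, recorded as the node together with the
eviction time starting the period. -/
noncomputable def touched (D : ℕ → Set V) (n : ℕ) : Finset (V × ℕ) :=
  ((Finset.univ ×ˢ Finset.Icc 1 n).filter fun p => p.1 ∉ E.cache p.2 ∧ p.1 ∈ D p.2).image
    fun p => (p.1, E.lastEv p.1 p.2)

theorem mem_touched {D : ℕ → Set V} {n : ℕ} {p : V × ℕ} :
    p ∈ E.touched D n ↔ ∃ r, (1 ≤ r ∧ r ≤ n) ∧ p.1 ∉ E.cache r ∧ p.1 ∈ D r ∧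
      E.lastEv p.1 r = p.2 := by
  obtain ⟨v, e⟩ := p
  simp only [touched, Finset.mem_image, Finset.mem_filter, Finset.mem_product, Finset.mem_univ,
    true_and, Finset.mem_Icc, Prod.exists, Prod.mk.injEq]
  constructor
  · rintro ⟨_, r, ⟨h1, h2, h3⟩, rfl, h4⟩
    exact ⟨r, h1, h2, h3, h4⟩
  · rintro ⟨r, h1, h2, h3, h4⟩
    exact ⟨v, r, ⟨h1, h2, h3⟩, rfl, h4⟩

theorem touched_subset (D : ℕ → Set V) (n : ℕ) :
    E.touched D n ⊆ (evictions D n).image (fun p => (p.1, E.lastEv p.1 p.2)) ∪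
      (E.heldPairs D n).image (fun p => (p.1, E.lastEv p.1 p.2)) ∪
      (Finset.univ.filter (· ∈ D n)).image (fun v => (v, E.lastEv v n)) := by
  rintro ⟨v, e⟩ hp
  obtain ⟨r, ⟨hr1, hrn⟩, hC, hDr, he⟩ := E.mem_touched.1 hp
  dsimp only at hC hDr he
  simp only [Finset.mem_union, Finset.mem_image, Prod.mk.injEq]
  obtain ⟨q, hrq, hqn, hev, hq⟩ : ∃ q, r ≤ q ∧ q ≤ n ∧ E.lastEv v q = e ∧
      (q = n ∨ (v ∈ E.cache q ∧ v ∉ E.cache (q + 1))) := by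
    by_cases h : ∃ q, r ≤ q ∧ q < n ∧ v ∈ E.cache q ∧ v ∉ E.cache (q + 1)
    · obtain ⟨h1, h2, h3⟩ := Nat.find_spec h
      refine ⟨Nat.find h, h1, h2.le, ?_, Or.inr h3⟩
      rw [← he]
      refine E.lastEv_eq_of_forall h1 fun s hs hsq hsC => ?_
      by_contra hsC'
      exact Nat.find_min h hsq ⟨hs, by omega, hsC, hsC'⟩
    · refine ⟨n, hrn, le_rfl, ?_, Or.inl rfl⟩
      rw [← he]
      refine E.lastEv_eq_of_forall hrn fun s hs hsq hsC => ?_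
      by_contra hsC'
      exact h ⟨s, hs, hsq, hsC, hsC'⟩
  have hevm : ∀ m, r ≤ m → m ≤ q → E.lastEv v m = e := by
    intro m hrm hmq
    rw [← he]
    refine E.lastEv_eq_of_forall hrm fun s hs hsm hsC => ?_
    by_contra hsC'
    have h1 := E.le_lastEv (v := v) (s := s) (t := q) (by omega) ⟨hsC, hsC'⟩
    have h2 := E.lastEv_lt (v := v) (t := r) hr1
    omega
  by_cases hm : ∃ m, r ≤ m ∧ m < q ∧ v ∈ D m ∧ v ∉ D (m + 1)
  · obtain ⟨m, h1, h2, h3⟩ := hm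
    refine Or.inl (Or.inl ⟨(v, m), ?_, rfl, hevm m h1 h2.le⟩)
    simp only [evictions, Finset.mem_filter, Finset.mem_product, Finset.mem_univ, true_and,
      Finset.mem_Ico]
    exact ⟨⟨by omega, by omega⟩, h3⟩
  · have hD : ∀ s, r ≤ s → s ≤ q → v ∈ D s := by
      intro s hs
      induction s, hs using Nat.le_induction with
      | base => exact fun _ => hDr
      | succ s hs ih =>
        intro hsq
        by_contra h
        exact hm ⟨s, hs, hsq, ih (by omega), h⟩
    rcases hq with rfl | hq
    · exact Or.inr ⟨v, by simpa using hD q hrq le_rfl, rfl, hev⟩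
    · refine Or.inl (Or.inr ⟨(v, q), ?_, rfl, hev⟩)
      simp only [heldPairs, Finset.mem_filter, Finset.mem_product, Finset.mem_univ, true_and,
        Finset.mem_Icc]
      refine ⟨⟨by omega, hqn⟩, hq, fun s hs hsq => hD s ?_ hsq⟩
      by_contra hlt
      exact hC ((E.mem_cache_iff_of_lastChg_lt (by omega) hrq).2 hq.1)

theorem card_touched_le (D : ℕ → Set V) (n : ℕ) :
    (E.touched D n).card ≤
      (evictions D n).card + (E.heldPairs D n).card + (D n).ncard := by
  rw [ncard_eq_card_filter]
  refine (Finset.card_le_card (E.touched_subset D n)).trans ((Finset.card_union_le _ _).trans ?_)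
  exact Nat.add_le_add ((Finset.card_union_le _ _).trans
    (Nat.add_le_add Finset.card_image_le Finset.card_image_le)) Finset.card_image_le

/-- The positive requests that are free for `D` are charged to the out periods it touches. -/
theorem card_free_pos_le (hα : 1 ≤ α) (hG : E.GoodReq) {D : ℕ → Set V}
    (hD : ∀ r, T.Subforest (D r)) (n : ℕ) :
    ((Finset.Icc 1 n).filter fun r => (req r).2 = true ∧ (req r).1 ∈ D r).card
      ≤ T.height * ((E.touched D n).card * α) := by
  have hex : ∀ p ∈ E.touched D n, ∃ m, ((1 ≤ m ∧ m ≤ n) ∧ p.1 ∉ E.cache m ∧ p.1 ∈ D m ∧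
      E.lastEv p.1 m = p.2) ∧ ∀ r, (1 ≤ r ∧ r ≤ n) ∧ p.1 ∉ E.cache r ∧ p.1 ∈ D r ∧
      E.lastEv p.1 r = p.2 → r ≤ m := by
    intro p hp
    obtain ⟨r, hr⟩ := E.mem_touched.1 hp
    have hr' := Nat.findGreatest_spec (P := fun m => (1 ≤ m ∧ m ≤ n) ∧ p.1 ∉ E.cache m ∧
      p.1 ∈ D m ∧ E.lastEv p.1 m = p.2) hr.1.2 hr
    exact ⟨_, hr', fun s hs => Nat.le_findGreatest hs.1.2 hs⟩
  choose! m hm hmax using hex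
  set rel : V × ℕ → V × ℕ → Prop := fun p q =>
    q.1 ∈ T.subtree p.1 ∧ q.1 ∉ E.cache (m p) ∧ E.lastEv q.1 (m p) = q.2 with hrel
  have hfiber : ∀ p ∈ E.touched D n,
      (((Finset.Icc 1 n).filter fun r => (req r).2 = true ∧ (req r).1 ∈ D r).filter
        fun r => ((req r).1, E.lastEv (req r).1 r) = p).card
        ≤ ((E.touched D n).bipartiteAbove rel p).card * α := by
    intro p hp
    obtain ⟨hm1, hmC, hmD, hme⟩ := hm p hp
    have h1 : (((Finset.Icc 1 n).filter fun r => (req r).2 = true ∧ (req r).1 ∈ D r).filter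
        fun r => ((req r).1, E.lastEv (req r).1 r) = p).card
        ≤ cntSum (E.cnt (m p)) (T.subtree p.1 \ E.cache (m p)) := by
      refine E.card_le_cntSum hG fun r hr => ?_
      simp only [Finset.mem_filter, Finset.mem_Icc] at hr
      obtain ⟨⟨hrn, hrs, hrD⟩, hrp⟩ := hr
      have hv : (req r).1 = p.1 := congrArg Prod.fst hrp
      have he : E.lastEv (req r).1 r = p.2 := congrArg Prod.snd hrp
      have hrC := (hG r hrn.1).1 hrs
      rw [hv] at he hrC hrD ⊢
      refine ⟨⟨RTree.self_mem_subtree _, hmC⟩, Finset.mem_Ioc.2 ⟨?_, ?_⟩⟩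
      · rw [← E.lastEv_eq_lastChg hmC, hme, ← he]
        exact E.lastEv_lt hrn.1
      · exact hmax p hp r ⟨hrn, hrC, hrD, he⟩
    have h2 := E.cntSum_le hα (Or.inl ((E.cache_subforest (m p)).validPos_subtree_diff hmC))
    refine h1.trans (h2.trans (Nat.mul_le_mul_right α ?_))
    rw [ncard_eq_card_filter]
    refine Finset.card_le_card_of_injOn (fun w => (w, E.lastEv w (m p))) ?_ ?_
    · intro w hw
      simp only [Finset.coe_filter, Set.mem_ofPred_eq, Finset.mem_univ, true_and] at hw
      refine Finset.mem_coe.2 ((Finset.mem_bipartiteAbove rel).2 ⟨E.mem_touched.2 ?_, hw.1, hw.2, rfl⟩)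
      exact ⟨m p, hm1, hw.2, hD _ _ hmD hw.1, rfl⟩
    · intro w _ w' _ h
      exact congrArg Prod.fst h
  have hbelow : ∀ q ∈ E.touched D n,
      ((E.touched D n).bipartiteBelow rel q).card ≤ T.height := by
    intro q _
    refine le_trans ?_ (RTree.card_ancestors_le_height (T := T) q.1)
    have hinj : ∀ p ∈ E.touched D n, ∀ p' ∈ E.touched D n, rel p q → rel p' q →
        p.1 = p'.1 → m p ≤ m p' → p = p' := by
      intro p hp p' hp' h h' hv hle
      refine Prod.ext hv ?_
      rw [← (hm p hp).2.2.2, ← (hm p' hp').2.2.2, ← hv]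
      refine (E.lastEv_eq_of_forall hle fun s hs hs' hC => ?_).symm
      have hq : E.lastChg q.1 (m p') < m p := by
        rw [← E.lastEv_eq_lastChg h'.2.1, h'.2.2, ← h.2.2]
        exact E.lastEv_lt (hm p hp).1.1
      exact absurd ((E.mem_cache_iff_of_lastChg_lt (by omega) hs'.le).1
        (E.cache_subforest s _ hC h.1)) h'.2.1
    refine Finset.card_le_card_of_injOn Prod.fst ?_ ?_
    · intro p hp
      have := ((Finset.mem_bipartiteBelow rel).1 (Finset.mem_coe.1 hp)).2.1
      simpa using this
    · intro p hp p' hp' hv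
      obtain ⟨h1, h2⟩ := (Finset.mem_bipartiteBelow rel).1 (Finset.mem_coe.1 hp)
      obtain ⟨h1', h2'⟩ := (Finset.mem_bipartiteBelow rel).1 (Finset.mem_coe.1 hp')
      rcases le_total (m p) (m p') with hle | hle
      · exact hinj p h1 p' h1' h2 h2' hv hle
      · exact (hinj p' h1' p h1 h2' h2 hv.symm hle).symm
  rw [Finset.card_eq_sum_card_fiberwise (f := fun r => ((req r).1, E.lastEv (req r).1 r))
    (t := E.touched D n)]
  · refine (Finset.sum_le_sum hfiber).trans ?_
    rw [← Finset.sum_mul, Finset.sum_card_bipartiteAbove_eq_sum_card_bipartiteBelow,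
      ← mul_assoc]
    refine Nat.mul_le_mul_right α ((Finset.sum_le_card_nsmul _ _ _ hbelow).trans ?_)
    rw [smul_eq_mul, mul_comm]
  · intro r hr
    simp only [Finset.coe_filter, Set.mem_ofPred_eq, Finset.mem_Icc] at hr
    exact Finset.mem_coe.2 (E.mem_touched.2
      ⟨r, hr.1, (hG r hr.1.1).1 hr.2.1, hr.2.2, rfl⟩)

/-- The number of positive requests is bounded by the cost of any offline schedule. -/
theorem signCount_true_le (hα : 1 ≤ α) (hG : E.GoodReq) {D : ℕ → Set V} {k : ℕ}
    (hD : IsSchedule T k D) (n : ℕ) :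
    signCount req true n ≤
      T.height * (serveCost req D 1 n + moveCost α D 1 n + k * α) := by
  have hsub := fun r => (hD r).1
  have h1 := E.card_free_pos_le hα hG hsub n
  have h2 := E.card_heldPairs_mul_le hα hG hsub n
  have h3 := mul_card_evictions_le α D n
  have h4 := Nat.mul_le_mul_right α
    ((E.card_touched_le D n).trans (Nat.add_le_add_left (hD n).2 _))
  rw [add_mul, add_mul, Nat.mul_comm (evictions D n).card] at h4
  have h5 : ((Finset.Icc 1 n).filter fun r => (req r).2 = true ∧ (req r).1 ∉ D r).card +
      ((Finset.Icc 1 n).filter fun r => (req r).2 = false ∧ (req r).1 ∈ D r).card ≤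
      serveCost req D 1 n := by
    rw [← Finset.card_union_of_disjoint]
    · refine Finset.card_le_card fun r hr => ?_
      simp only [Finset.mem_union, Finset.mem_filter, ← and_or_left] at hr
      exact Finset.mem_filter.2 hr
    · refine Finset.disjoint_filter.2 fun r _ h h' => ?_
      simp [h.1] at h'
  have h6 : signCount req true n =
      ((Finset.Icc 1 n).filter fun r => (req r).2 = true ∧ (req r).1 ∈ D r).card +
      ((Finset.Icc 1 n).filter fun r => (req r).2 = true ∧ (req r).1 ∉ D r).card := by
    unfold signCount
    rw [← Finset.card_filter_add_card_filter_not (fun r => (req r).1 ∈ D r),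
      Finset.filter_filter, Finset.filter_filter]
  have h7 : 1 ≤ T.height := Nat.le_add_left 1 _
  rw [h6]
  generalize ((Finset.Icc 1 n).filter fun r => (req r).2 = true ∧ (req r).1 ∉ D r).card = a at *
  generalize ((Finset.Icc 1 n).filter fun r => (req r).2 = false ∧ (req r).1 ∈ D r).card = b at *
  calc _ ≤ T.height * ((E.touched D n).card * α) + T.height * a :=
        Nat.add_le_add h1 (Nat.le_mul_of_pos_left a h7)
    _ = T.height * ((E.touched D n).card * α + a) := by ring
    _ ≤ _ := Nat.mul_le_mul_left _ (by omega)

end TCPhase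

theorem exists_schedule_optCostFrom {V : Type} [Fintype V] (T : RTree V) (α k : ℕ)
    (ρ : ℕ → Request V) (a b : ℕ) :
    ∃ D : ℕ → Set V, IsSchedule T k D ∧
      optCostFrom T α k ρ a b = serveCost ρ D a b + moveCost α D a b :=
  Nat.sInf_mem (s := {n | ∃ D : ℕ → Set V, IsSchedule T k D ∧
    n = serveCost ρ D a b + moveCost α D a b})
    ⟨_, fun _ => ∅, fun _ => ⟨fun v hv => absurd hv (Set.notMem_empty v), by simp⟩, rfl⟩

/-- there is a universal constant `c > 0` such that for every phase `P`
of `TC` (with `α` even), `TC(P) ≤ c·h(T)·OPT(P) + c·h(T)·(k_P + kONL)·α`, where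
`OPT(P)` is the optimal offline cost of serving the requests of `P` with cache size
`kOPT`, starting from an arbitrary cache. -/
theorem tc_phase_bound :
    ∃ c : ℝ, 0 < c ∧
      ∀ (V : Type) [Fintype V] [DecidableEq V],
        ∀ (T : RTree V) (α kONL kOPT : ℕ) (req : ℕ → Request V)
          (E : TCPhase T α req) (tEnd : ℕ),
          1 ≤ α → Even α → 1 ≤ kOPT → kOPT ≤ kONL →
          E.GoodReq → E.PhaseEnd kONL tEnd →
          (E.tcCost kONL tEnd : ℝ) ≤
            c * (T.height : ℝ) * (optCostFrom T α kOPT req 1 tEnd : ℝ)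
            + c * (T.height : ℝ) * ((E.kP tEnd : ℝ) + (kONL : ℝ)) * (α : ℝ) := by
  refine ⟨5, by norm_num, ?_⟩
  intro V _ _ T α kONL kOPT req E tEnd hα _ _ hk hG hP
  obtain ⟨D, hD, hopt⟩ := exists_schedule_optCostFrom T α kOPT req 1 tEnd
  have h1 := E.tcCost_le hα hG hP
  have h2 := E.signCount_true_le hα hG hD tEnd
  rw [← hopt] at h2
  have h3 : 1 ≤ T.height := Nat.le_add_left 1 _
  have h4 : T.height * (kOPT * α) ≤ T.height * (kONL * α) :=
    Nat.mul_le_mul_left _ (Nat.mul_le_mul_right _ hk)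
  have h5 : α * kONL ≤ T.height * (α * kONL) := Nat.le_mul_of_pos_left _ h3
  have h6 : α * E.kP tEnd ≤ T.height * (α * E.kP tEnd) := Nat.le_mul_of_pos_left _ h3
  have key : E.tcCost kONL tEnd ≤ 5 * T.height * optCostFrom T α kOPT req 1 tEnd +
      5 * T.height * (E.kP tEnd + kONL) * α := by
    nlinarith
  exact_mod_cast key
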